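/- In the setting of Floer's reduction lemma, with Φ : C' → C the ℤ-linear map given on basis elements by Φq := q − ν(q,p̄)·q̄ and Ψ : C → C' the ℤ-linear map given by Ψq := q for q ∈ P', Ψq̄ := 0, Ψp̄ := −Σ_{p ∈ P'} ν(q̄,p)·p, one has Ψ ∘ Φ = id_{C'} and id_C − Φ ∘ Ψ = ∂ ∘ T + T ∘ ∂, where T : C → C is the ℤ-linear map with T p̄ = q̄ and T q = 0 for every basis element q ∈ P ∖ {p̄}. -/

import Mathlib

/-- The boundary operator `∂ = ∂^ν` of the free ℤ-module `C(P) = (P → ℤ)`, determined on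
basis elements by `∂q = Σ_{p ∈ P} ν(q,p)·p`; on a function `f` it is given by
`(∂f)(p) = Σ_{q ∈ P} ν(q,p)·f(q)`. -/
def bdryFun {P : Type*} [Fintype P] (ν : P → P → ℤ) (f : P → ℤ) : P → ℤ :=
  fun p => ∑ q : P, ν q p * f q

/-- The ℤ-linear map `Φ : C' → C` determined on basis elements `q ∈ P'` by
`Φq := q − ν(q,p̄)·q̄`. -/
def PhiFun {P : Type*} [Fintype P] [DecidableEq P] (ν : P → P → ℤ) (pbar qbar : P)
    (f : {x : P // x ≠ pbar ∧ x ≠ qbar} → ℤ) : P → ℤ :=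
  fun x =>
    (if h : x ≠ pbar ∧ x ≠ qbar then f ⟨x, h⟩ else 0) -
      (if x = qbar then ∑ q : {x : P // x ≠ pbar ∧ x ≠ qbar}, ν q.1 pbar * f q else 0)

/-- The ℤ-linear map `Ψ : C → C'` determined on basis elements by `Ψq := q` for `q ∈ P'`,
`Ψq̄ := 0`, and `Ψp̄ := −Σ_{p ∈ P'} ν(q̄,p)·p`. -/
def PsiFun {P : Type*} (ν : P → P → ℤ) (pbar qbar : P)
    (f : P → ℤ) : {x : P // x ≠ pbar ∧ x ≠ qbar} → ℤ :=
  fun p => f p.1 - f pbar * ν qbar p.1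

/-- The ℤ-linear map `T : C → C` with `T p̄ = q̄` and `T q = 0` for every basis element
`q ∈ P ∖ {p̄}`: the coefficient of `Tf` at `q̄` is `f(p̄)` and all other coefficients
vanish. -/
def TFun {P : Type*} [DecidableEq P] (pbar qbar : P) (f : P → ℤ) : P → ℤ :=
  fun x => if x = qbar then f pbar else 0

/-- A finite sum splits off its terms at two distinct points. -/
theorem sum_eq_add_add_sum_subtype_ne {P M : Type*} [Fintype P] [DecidableEq P]
    [AddCommMonoid M] {a b : P} (hab : a ≠ b) (g : P → M) :
    ∑ x : P, g x = g a + g b + ∑ x : {x : P // x ≠ a ∧ x ≠ b}, g x.1 := by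
  have h : ∑ x ∈ (Finset.univ.erase a).erase b, g x =
      ∑ x : {x : P // x ≠ a ∧ x ≠ b}, g x.1 :=
    Finset.sum_subtype _ (by simp [and_comm]) g
  rw [← h, add_assoc, Finset.add_sum_erase _ _ (by simp [hab.symm]),
    Finset.add_sum_erase _ _ (Finset.mem_univ a)]

/-- **Floer's reduction lemma, Step 4.**  In the setting of Floer's reduction lemma, with
`Φ : C' → C` given on basis elements by `Φq := q − ν(q,p̄)·q̄` and `Ψ : C → C'` given by
`Ψq := q` for `q ∈ P'`, `Ψq̄ := 0`, `Ψp̄ := −Σ_{p ∈ P'} ν(q̄,p)·p`, one has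
`Ψ ∘ Φ = id` and `id − Φ ∘ Ψ = ∂ ∘ T + T ∘ ∂`, where `T : C → C` is the ℤ-linear map
with `T p̄ = q̄` and `T q = 0` for every basis element `q ∈ P ∖ {p̄}`. -/
theorem floer_reduction_homotopy {P : Type*} [Fintype P] [DecidableEq P]
    (ν : P → P → ℤ)
    (hν : ∀ r p : P, ∑ q : P, ν r q * ν q p = 0)
    (pbar qbar : P) (hne : pbar ≠ qbar) (hone : ν qbar pbar = 1) :
    (∀ f : {x : P // x ≠ pbar ∧ x ≠ qbar} → ℤ,
        PsiFun ν pbar qbar (PhiFun ν pbar qbar f) = f) ∧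
    (∀ f : P → ℤ,
        f - PhiFun ν pbar qbar (PsiFun ν pbar qbar f) =
          bdryFun ν (TFun pbar qbar f) + TFun pbar qbar (bdryFun ν f)) := by
  constructor
  · intro f
    funext x
    simp [PsiFun, PhiFun, x.2, hne]
  · intro f
    have hT (p : P) : ∑ q : P, ν q p * TFun pbar qbar f q = ν qbar p * f pbar := by
      simp [TFun]
    funext x
    simp only [Pi.sub_apply, Pi.add_apply, bdryFun, hT]
    by_cases hq : x = qbar
    · subst hq
      have h := hν x pbar
      rw [sum_eq_add_add_sum_subtype_ne hne, hone] at h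
      have hs : ∑ q : {y : P // y ≠ pbar ∧ y ≠ x}, ν q.1 pbar * (f q.1 - f pbar * ν x q.1) =
          ∑ q : {y : P // y ≠ pbar ∧ y ≠ x}, ν q.1 pbar * f q.1 -
            f pbar * ∑ q : {y : P // y ≠ pbar ∧ y ≠ x}, ν x q.1 * ν q.1 pbar := by
        rw [Finset.mul_sum, ← Finset.sum_sub_distrib]
        exact Finset.sum_congr rfl fun q _ => by ring
      simp only [PhiFun, PsiFun, TFun, ne_eq, not_true_eq_false, and_false, dite_false,
        if_true] at hs ⊢
      rw [hs, bdryFun, sum_eq_add_add_sum_subtype_ne hne, hone]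
      linear_combination (-f pbar) * h
    · by_cases hp : x = pbar
      · subst hp
        simp [PhiFun, TFun, hne, hone]
      · simp [PhiFun, PsiFun, TFun, hp, hq, mul_comm]
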